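/- Let {e_k}_{k≥1} be an orthonormal basis for an infinite-dimensional separable Hilbert space H and set W_j := span{e_1, e_j} for j ≥ 1. Then {W_j}_{j≥1} is an information packet for H, but for every choice of weights ω_j > 0, the family {W_j, ω_j}_{j≥1} is not a fusion frame. -/

import Mathlib

open MeasureTheory

noncomputable section

/-- A family of closed subspaces of a Hilbert space is an information packet if every
vector admits an unconditionally convergent expansion with terms in the subspaces. -/
def InformationPacket {H : Type*} [NormedAddCommGroup H] [InnerProductSpace ℂ H]
    {J : Type*} (W : J → Submodule ℂ H) : Prop :=
  (∀ j, IsClosed (W j : Set H)) ∧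
    ∀ f : H, ∃ g : J → H, (∀ j, g j ∈ W j) ∧ HasSum g f


/-- `P` is the orthogonal projection of `H` onto the closed subspace `K`. -/
def IsOrthoProjOn {H : Type*} [NormedAddCommGroup H] [InnerProductSpace ℂ H]
    (K : Submodule ℂ H) (P : H →L[ℂ] H) : Prop :=
  ∀ f : H, P f ∈ K ∧ f - P f ∈ Kᗮ

theorem IsOrthoProjOn.apply_of_mem {H : Type*} [NormedAddCommGroup H] [InnerProductSpace ℂ H]
    {K : Submodule ℂ H} {P : H →L[ℂ] H} (hP : IsOrthoProjOn K P) {f : H} (hf : f ∈ K) :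
    P f = f := by
  have h : f - P f ∈ K ⊓ Kᗮ := ⟨K.sub_mem hf (hP f).1, (hP f).2⟩
  rw [K.inf_orthogonal_eq_bot, Submodule.mem_bot, sub_eq_zero] at h
  exact h.symm

theorem IsOrthoProjOn.apply_of_mem_orthogonal {H : Type*} [NormedAddCommGroup H]
    [InnerProductSpace ℂ H] {K : Submodule ℂ H} {P : H →L[ℂ] H} (hP : IsOrthoProjOn K P)
    {f : H} (hf : f ∈ Kᗮ) : P f = 0 := by
  have h : P f ∈ K ⊓ Kᗮ :=
    ⟨(hP f).1, by simpa using Kᗮ.sub_mem hf (hP f).2⟩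
  rwa [K.inf_orthogonal_eq_bot, Submodule.mem_bot] at h

theorem stmt6 {H : Type*} [NormedAddCommGroup H] [InnerProductSpace ℂ H] [CompleteSpace H]
    (e : HilbertBasis ℕ ℂ H)
    (W : ℕ → Submodule ℂ H)
    (hW : ∀ j, W j = Submodule.span ℂ ({e 0, e j} : Set H)) :
    InformationPacket W ∧
    ∀ ω : ℕ → ℝ, (∀ j, 0 < ω j) →
      ∀ P : ℕ → H →L[ℂ] H, (∀ j, IsOrthoProjOn (W j) (P j)) →
        ¬ ∃ A B : ℝ, 0 < A ∧ 0 < B ∧ ∀ f : H,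
            A * ‖f‖ ^ 2 ≤ ∑' j, ω j ^ 2 * ‖P j f‖ ^ 2 ∧
            ∑' j, ω j ^ 2 * ‖P j f‖ ^ 2 ≤ B * ‖f‖ ^ 2 := by
  refine ⟨⟨fun j => ?_, fun f => ⟨fun j => e.repr f j • e j, fun j => ?_, e.hasSum_repr f⟩⟩, ?_⟩
  · have : FiniteDimensional ℂ (W j) := by
      rw [hW]
      exact FiniteDimensional.span_of_finite ℂ (Set.toFinite _)
    exact (W j).closed_of_finiteDimensional
  · rw [hW]
    exact Submodule.smul_mem _ _ (Submodule.subset_span (by simp))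
  rintro ω - P hP ⟨A, B, hA, -, hAB⟩
  have hzero : ∀ j, P j (e 0) = e 0 := fun j =>
    (hP j).apply_of_mem (by rw [hW]; exact Submodule.subset_span (by simp))
  have hself : ∀ j, P j (e j) = e j := fun j =>
    (hP j).apply_of_mem (by rw [hW]; exact Submodule.subset_span (by simp))
  have hne : ∀ j k, k ≠ 0 → j ≠ k → P j (e k) = 0 := fun j k hk hjk => by
    refine (hP j).apply_of_mem_orthogonal ?_
    rw [hW, Submodule.mem_orthogonal]
    intro u hu
    obtain ⟨a, b, rfl⟩ := Submodule.mem_span_pair.1 hu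
    simp [inner_add_left, inner_smul_left, e.orthonormal.2 hk.symm, e.orthonormal.2 hjk]
  have hsum : Summable fun j => ω j ^ 2 := by
    by_contra h
    have h0 := (hAB (e 0)).1
    simp only [hzero, e.orthonormal.1, one_pow, mul_one, tsum_eq_zero_of_not_summable h] at h0
    exact h0.not_gt hA
  have hlower : ∀ k, k ≠ 0 → A ≤ ω k ^ 2 := fun k hk => by
    have hk' := (hAB (e k)).1
    rw [tsum_eq_single k fun j hj => by simp [hne j k hk hj]] at hk'
    simpa [hself, e.orthonormal.1] using hk'
  obtain ⟨k, hlt, hk⟩ := ((hsum.tendsto_atTop_zero.eventually_lt_const hA).and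
    (Filter.eventually_ne_atTop 0)).exists
  exact (hlower k hk).not_gt hlt
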